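/- Let G₀, G₁ : ℝⁿ → ℝ be smooth functions and define G : ℝ × ℝⁿ → ℝ by G(t,y) = (1−t)G₀(y) + tG₁(y). Let F : ℝ × ℝⁿ → ℝ be a smooth function such that for every (t,x) the Hessian matrix Hessₓ F(t,x) is invertible and the Legendre relation G(t, ∇ₓF(t,x)) = ⟨x, ∇ₓF(t,x)⟩ − F(t,x) holds. Then F satisfies the geodesic equation: for all (t,x), (∂²F/∂t²)(t,x) = ⟨(Hessₓ F(t,x))⁻¹ · ∇ₓ(∂F/∂t)(t,x), ∇ₓ(∂F/∂t)(t,x)⟩. -/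

import Mathlib

/-- The partial derivative `∂F/∂t` of `F : ℝ × ℝⁿ → ℝ` in the first (time) variable. -/
noncomputable def tDeriv (n : ℕ) (F : ℝ × (Fin n → ℝ) → ℝ) (p : ℝ × (Fin n → ℝ)) : ℝ :=
  fderiv ℝ F p (1, 0)

/-- The gradient `∇ₓF` of `F : ℝ × ℝⁿ → ℝ` in the `ℝⁿ`-variable. -/
noncomputable def xGrad (n : ℕ) (F : ℝ × (Fin n → ℝ) → ℝ) (p : ℝ × (Fin n → ℝ)) :
    Fin n → ℝ :=
  fun i => fderiv ℝ F p (0, Pi.single i 1)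

/-- The Hessian matrix `Hessₓ F` of `F : ℝ × ℝⁿ → ℝ` in the `ℝⁿ`-variable. -/
noncomputable def xHess (n : ℕ) (F : ℝ × (Fin n → ℝ) → ℝ) (p : ℝ × (Fin n → ℝ)) :
    Matrix (Fin n) (Fin n) ℝ :=
  fun i j => fderiv ℝ (fun q => xGrad n F q j) p (0, Pi.single i 1)

theorem contDiff_xGrad {n : ℕ} {F : ℝ × (Fin n → ℝ) → ℝ} (hF : ContDiff ℝ (⊤ : ℕ∞) F) :
    ContDiff ℝ (⊤ : ℕ∞) (xGrad n F) :=
  contDiff_pi.2 fun _ => (hF.fderiv_right (m := (⊤ : ℕ∞)) (by simp)).clm_apply contDiff_const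

theorem fderiv_xGrad_apply {n : ℕ} {F : ℝ × (Fin n → ℝ) → ℝ} (hF : ContDiff ℝ (⊤ : ℕ∞) F)
    (p w : ℝ × (Fin n → ℝ)) (j : Fin n) :
    fderiv ℝ (xGrad n F) p w j = fderiv ℝ (fun q => xGrad n F q j) p w := by
  have h : DifferentiableAt ℝ (xGrad n F) p :=
    (contDiff_xGrad hF).differentiable (by simp) p
  rw [((hasFDerivAt_pi'.1 h.hasFDerivAt) j).fderiv]
  rfl

/-- The time derivative and the spatial gradient commute. -/
theorem fderiv_xGrad_time {n : ℕ} {F : ℝ × (Fin n → ℝ) → ℝ} (hF : ContDiff ℝ (⊤ : ℕ∞) F)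
    (p : ℝ × (Fin n → ℝ)) :
    fderiv ℝ (xGrad n F) p (1, 0) = xGrad n (tDeriv n F) p := by
  have hd : DifferentiableAt ℝ (fderiv ℝ F) p :=
    (hF.fderiv_right (m := (⊤ : ℕ∞)) (by simp)).differentiable (by simp) p
  have hs : IsSymmSndFDerivAt ℝ F p :=
    hF.contDiffAt.isSymmSndFDerivAt (by
      simp only [minSmoothness_of_isRCLikeNormedField]
      exact (WithTop.coe_le_coe.2 le_top : ((2 : ℕ∞) : WithTop ℕ∞) ≤ ((⊤ : ℕ∞) : WithTop ℕ∞)))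
  have key (v w : ℝ × (Fin n → ℝ)) :
      fderiv ℝ (fun q => fderiv ℝ F q v) p w = fderiv ℝ (fderiv ℝ F) p w v := by
    rw [fderiv_clm_apply hd (differentiableAt_const v)]
    simp
  ext j
  rw [fderiv_xGrad_apply hF]
  exact (key _ _).trans ((hs _ _).trans (key _ _).symm)

theorem fderiv_apply_eq_tDeriv_add {n : ℕ} (F : ℝ × (Fin n → ℝ) → ℝ)
    (p : ℝ × (Fin n → ℝ)) (s : ℝ) (v : Fin n → ℝ) :
    fderiv ℝ F p (s, v) = s * tDeriv n F p + ∑ i, v i * xGrad n F p i := by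
  have h : (s, v) = s • ((1 : ℝ), (0 : Fin n → ℝ)) +
      ∑ i, v i • ((0 : ℝ), (Pi.single i 1 : Fin n → ℝ)) := by
    ext j
    · simp [Prod.fst_sum]
    · simp [Prod.snd_sum, Finset.sum_apply, Pi.single_apply]
  rw [h, map_add, map_sum]
  simp only [map_smul, smul_eq_mul]
  rfl

theorem clm_apply_eq_sum_single {n : ℕ} (L : (Fin n → ℝ) →L[ℝ] ℝ) (v : Fin n → ℝ) :
    L v = ∑ j, v j * L (Pi.single j 1) := by
  conv_lhs => rw [pi_eq_sum_univ' v, map_sum]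
  simp only [map_smul, smul_eq_mul]

/-- The Legendre relation differentiated along `(s, v)`. -/
theorem fderiv_legendre {n : ℕ} {G₀ G₁ : (Fin n → ℝ) → ℝ} {F : ℝ × (Fin n → ℝ) → ℝ}
    (hG₀ : ContDiff ℝ (⊤ : ℕ∞) G₀) (hG₁ : ContDiff ℝ (⊤ : ℕ∞) G₁) (hF : ContDiff ℝ (⊤ : ℕ∞) F)
    (hLeg : ∀ (t : ℝ) (x : Fin n → ℝ),
      (1 - t) * G₀ (xGrad n F (t, x)) + t * G₁ (xGrad n F (t, x))
        = (∑ i : Fin n, x i * xGrad n F (t, x) i) - F (t, x))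
    (p : ℝ × (Fin n → ℝ)) (s : ℝ) (v : Fin n → ℝ) :
    s * (G₁ (xGrad n F p) - G₀ (xGrad n F p) + tDeriv n F p) +
      ∑ j, fderiv ℝ (xGrad n F) p (s, v) j *
        ((1 - p.1) * fderiv ℝ G₀ (xGrad n F p) (Pi.single j 1) +
          p.1 * fderiv ℝ G₁ (xGrad n F p) (Pi.single j 1) - p.2 j) = 0 := by
  have hy : HasFDerivAt (xGrad n F) (fderiv ℝ (xGrad n F) p) p :=
    ((contDiff_xGrad hF).differentiable (by simp) p).hasFDerivAt
  have h₀ := ((hG₀.differentiable (by simp) (xGrad n F p)).hasFDerivAt).comp p hy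
  have h₁ := ((hG₁.differentiable (by simp) (xGrad n F p)).hasFDerivAt).comp p hy
  have hF' := (hF.differentiable (by simp) p).hasFDerivAt
  have ht : HasFDerivAt (fun q : ℝ × (Fin n → ℝ) => q.1) (ContinuousLinearMap.fst ℝ ℝ _) p :=
    hasFDerivAt_fst
  have hx (i : Fin n) : HasFDerivAt (fun q : ℝ × (Fin n → ℝ) => q.2 i)
      ((ContinuousLinearMap.proj i).comp (ContinuousLinearMap.snd ℝ ℝ (Fin n → ℝ))) p :=
    hasFDerivAt_pi'.1 hasFDerivAt_snd i
  have hl := ((ht.const_sub 1).mul h₀).add (ht.mul h₁)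
  have hr := (HasFDerivAt.fun_sum (u := Finset.univ)
    fun i _ => (hx i).mul (hasFDerivAt_pi'.1 hy i)).sub hF'
  have e := congrArg (fun L => L (s, v)) (hl.unique (hr.congr_of_eventuallyEq
    (Filter.Eventually.of_forall fun q => hLeg q.1 q.2)))
  simp [fderiv_apply_eq_tDeriv_add F, Finset.sum_add_distrib] at e
  rw [clm_apply_eq_sum_single (fderiv ℝ G₀ _), clm_apply_eq_sum_single (fderiv ℝ G₁ _)] at e
  simp only [mul_sub, mul_add, Finset.sum_sub_distrib, Finset.sum_add_distrib,
    mul_left_comm _ (1 - p.1), mul_left_comm _ p.1, ← Finset.mul_sum]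
  simp only [mul_comm (p.2 _), mul_comm (xGrad n F p _)] at e
  linarith

/-- Along the Legendre transform of a linear segment, `Ḟ = -(G₁ - G₀) ∘ ∇ₓF`. -/
theorem tDeriv_eq_of_legendre {n : ℕ} {G₀ G₁ : (Fin n → ℝ) → ℝ} {F : ℝ × (Fin n → ℝ) → ℝ}
    (hG₀ : ContDiff ℝ (⊤ : ℕ∞) G₀) (hG₁ : ContDiff ℝ (⊤ : ℕ∞) G₁) (hF : ContDiff ℝ (⊤ : ℕ∞) F)
    (hHess : ∀ p : ℝ × (Fin n → ℝ), IsUnit (xHess n F p))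
    (hLeg : ∀ (t : ℝ) (x : Fin n → ℝ),
      (1 - t) * G₀ (xGrad n F (t, x)) + t * G₁ (xGrad n F (t, x))
        = (∑ i : Fin n, x i * xGrad n F (t, x) i) - F (t, x))
    (p : ℝ × (Fin n → ℝ)) :
    tDeriv n F p = (G₀ - G₁) (xGrad n F p) := by
  have key := fderiv_legendre hG₀ hG₁ hF hLeg p
  set c : Fin n → ℝ := fun j => (1 - p.1) * fderiv ℝ G₀ (xGrad n F p) (Pi.single j 1) +
    p.1 * fderiv ℝ G₁ (xGrad n F p) (Pi.single j 1) - p.2 j with hc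
  have hHc : (xHess n F p).mulVec c = 0 := by
    ext i
    have h := key 0 (Pi.single i 1)
    simp only [fderiv_xGrad_apply hF, zero_mul, zero_add] at h
    exact h
  have hc0 : c = 0 :=
    Matrix.mulVec_injective_of_isUnit (hHess p) (hHc.trans (Matrix.mulVec_zero _).symm)
  have h := key 1 0
  have hj (j : Fin n) : (1 - p.1) * fderiv ℝ G₀ (xGrad n F p) (Pi.single j 1) +
    p.1 * fderiv ℝ G₁ (xGrad n F p) (Pi.single j 1) - p.2 j = 0 := congrFun hc0 j
  simp only [hj, mul_zero, Finset.sum_const_zero] at h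
  simp only [Pi.sub_apply]
  linarith

/-- If `G(t,y) = (1−t)G₀(y) + tG₁(y)` is a linear segment of symplectic
potentials and `F` is a smooth family with invertible `Hessₓ F` satisfying the Legendre
relation `G(t, ∇ₓF(t,x)) = ⟨x, ∇ₓF(t,x)⟩ − F(t,x)`, then `F` satisfies the geodesic
equation `F̈ = ⟨(Hessₓ F)⁻¹ ∇ₓḞ, ∇ₓḞ⟩`. -/
theorem stmt_10 (n : ℕ) (G₀ G₁ : (Fin n → ℝ) → ℝ) (F : ℝ × (Fin n → ℝ) → ℝ)
    (hG₀ : ContDiff ℝ (⊤ : ℕ∞) G₀) (hG₁ : ContDiff ℝ (⊤ : ℕ∞) G₁) (hF : ContDiff ℝ (⊤ : ℕ∞) F)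
    (hHess : ∀ p : ℝ × (Fin n → ℝ), IsUnit (xHess n F p))
    (hLeg : ∀ (t : ℝ) (x : Fin n → ℝ),
      (1 - t) * G₀ (xGrad n F (t, x)) + t * G₁ (xGrad n F (t, x))
        = (∑ i : Fin n, x i * xGrad n F (t, x) i) - F (t, x)) :
    ∀ (t : ℝ) (x : Fin n → ℝ),
      tDeriv n (tDeriv n F) (t, x) =
        ∑ i : Fin n,
          ((xHess n F (t, x))⁻¹.mulVec (xGrad n (tDeriv n F) (t, x))) i *
            xGrad n (tDeriv n F) (t, x) i := by
  intro t x
  set p : ℝ × (Fin n → ℝ) := (t, x)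
  set L := fderiv ℝ (G₀ - G₁) (xGrad n F p)
  have hy : HasFDerivAt (xGrad n F) (fderiv ℝ (xGrad n F) p) p :=
    ((contDiff_xGrad hF).differentiable (by simp) p).hasFDerivAt
  have hD : HasFDerivAt (tDeriv n F) (L.comp (fderiv ℝ (xGrad n F) p)) p := by
    rw [funext (tDeriv_eq_of_legendre hG₀ hG₁ hF hHess hLeg)]
    exact (((hG₀.sub hG₁).differentiable (by simp) (xGrad n F p)).hasFDerivAt).comp p hy
  have hgrad : xGrad n (tDeriv n F) p =
      (xHess n F p).mulVec fun j => L (Pi.single j 1) := by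
    ext i
    rw [xGrad, hD.fderiv, ContinuousLinearMap.comp_apply, clm_apply_eq_sum_single]
    simp only [fderiv_xGrad_apply hF]
    rfl
  have hinv : (xHess n F p)⁻¹.mulVec (xGrad n (tDeriv n F) p) = fun j => L (Pi.single j 1) := by
    rw [hgrad, Matrix.mulVec_mulVec,
      Matrix.nonsing_inv_mul _ ((Matrix.isUnit_iff_isUnit_det _).1 (hHess p)), Matrix.one_mulVec]
  rw [hinv, tDeriv, hD.fderiv, ContinuousLinearMap.comp_apply, fderiv_xGrad_time hF,
    clm_apply_eq_sum_single]
  simp only [mul_comm]
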